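/- arXiv:2206.13764 — 3 statements merged into one kernel-verified Lean document; each statement's English description precedes it below -/
import Mathlib

section
/- Let h₁,…,h_k and y be random variables on a probability space, each taking values in a nonempty finite type. Assume that the family (h₁,…,h_k) is mutually independent, and is also conditionally mutually independent given y (i.e., for every value b of y with P(y=b) > 0, the conditional joint distribution of (h₁,…,h_k) given y=b is the product of the conditional marginals). Then the mutual information of the joint tuple with y decomposes additively: I((h₁,…,h_k); y) = Σ_{i=1}^{k} I(hᵢ; y). -/
open MeasureTheory Finset

/-- `pr P A a` is the probability `P(A = a)` (as a real number). -/
noncomputable def pr {Ω : Type*} [MeasurableSpace Ω] (P : Measure Ω)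
    {α : Type*} (A : Ω → α) (a : α) : ℝ :=
  (P {ω | A ω = a}).toReal

/-- Shannon entropy `H(A) = ∑ₐ −P(A=a)·log P(A=a)` (natural log, `0·log 0 = 0`). -/
noncomputable def ent {Ω : Type*} [MeasurableSpace Ω] (P : Measure Ω)
    {α : Type*} [Fintype α] (A : Ω → α) : ℝ :=
  ∑ a, Real.negMulLog (pr P A a)

/-- Mutual information `I(A;B) = H(A) + H(B) − H(A,B)`. -/
noncomputable def mi {Ω : Type*} [MeasurableSpace Ω] (P : Measure Ω)
    {α β : Type*} [Fintype α] [Fintype β] (A : Ω → α) (B : Ω → β) : ℝ :=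
  ent P A + ent P B - ent P (fun ω => (A ω, B ω))

/-- Conditional entropy `H(A|Y) = H(A,Y) − H(Y)`. -/
noncomputable def condEnt {Ω : Type*} [MeasurableSpace Ω] (P : Measure Ω)
    {α γ : Type*} [Fintype α] [Fintype γ] (A : Ω → α) (Y : Ω → γ) : ℝ :=
  ent P (fun ω => (A ω, Y ω)) - ent P Y

/-- Conditional mutual information `I(A;B|Y) = H(A|Y) + H(B|Y) − H((A,B)|Y)`. -/
noncomputable def cmi {Ω : Type*} [MeasurableSpace Ω] (P : Measure Ω)
    {α β γ : Type*} [Fintype α] [Fintype β] [Fintype γ]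
    (A : Ω → α) (B : Ω → β) (Y : Ω → γ) : ℝ :=
  condEnt P A Y + condEnt P B Y - condEnt P (fun ω => (A ω, B ω)) Y

/-- Interaction information `I(A;B;Y) = I(A;B) − I(A;B|Y)`. -/
noncomputable def interInfo {Ω : Type*} [MeasurableSpace Ω] (P : Measure Ω)
    {α β γ : Type*} [Fintype α] [Fintype β] [Fintype γ]
    (A : Ω → α) (B : Ω → β) (Y : Ω → γ) : ℝ :=
  mi P A B - cmi P A B Y

/-- Summing a joint distribution over one coordinate gives the marginal of the other. -/
theorem sum_pr_prodMk {Ω : Type*} [MeasurableSpace Ω] (P : Measure Ω) [IsFiniteMeasure P]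
    {α γ : Type*} [Fintype α] [MeasurableSpace α] [MeasurableSingletonClass α]
    {A : Ω → α} (hA : Measurable A) (Y : Ω → γ) (b : γ) :
    ∑ x, pr P (fun ω => (A ω, Y ω)) (x, b) = pr P Y b := by
  have key := sum_measureReal_preimage_singleton (μ := P.restrict (Y ⁻¹' {b})) univ
    (fun x _ => hA (measurableSet_singleton x))
  rw [coe_univ, Set.preimage_univ, measureReal_restrict_apply_univ] at key
  refine Eq.trans (sum_congr rfl fun x _ => ?_) key
  rw [measureReal_restrict_apply (hA (measurableSet_singleton x))]
  simp only [pr, Measure.real, Prod.mk.injEq]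
  rfl

theorem sum_pr {Ω : Type*} [MeasurableSpace Ω] (P : Measure Ω) [IsProbabilityMeasure P]
    {α : Type*} [Fintype α] [MeasurableSpace α] [MeasurableSingletonClass α]
    {A : Ω → α} (hA : Measurable A) : ∑ x, pr P A x = 1 := by
  have key := sum_measureReal_preimage_singleton (μ := P) univ
    (fun x _ => hA (measurableSet_singleton x))
  rw [coe_univ, Set.preimage_univ, probReal_univ] at key
  exact key

theorem negMulLog_prod {ι : Type*} [DecidableEq ι] (s : Finset ι) (x : ι → ℝ) :
    Real.negMulLog (∏ i ∈ s, x i)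
      = ∑ i ∈ s, ∏ j ∈ s, if j = i then Real.negMulLog (x j) else x j := by
  induction s using Finset.induction_on with
  | empty => simp
  | insert c s hc ih =>
    have hne : ∀ j ∈ s, j ≠ c := fun j hj hjc => hc (hjc ▸ hj)
    rw [prod_insert hc, Real.negMulLog_mul, ih, sum_insert hc, prod_insert hc, if_pos rfl,
      mul_comm, mul_sum]
    congr 1
    · rw [prod_congr rfl fun j hj => if_neg (hne j hj)]
    · refine sum_congr rfl fun i hi => ?_
      rw [prod_insert hc, if_neg (hne i hi).symm]

/-- The Shannon entropy of a product distribution is the sum of the entropies of its factors. -/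
theorem sum_negMulLog_prod {ι : Type*} [Fintype ι] [DecidableEq ι] {α : ι → Type*}
    [∀ i, Fintype (α i)] (p : ∀ i, α i → ℝ) (hp : ∀ i, ∑ x, p i x = 1) :
    ∑ a : ∀ i, α i, Real.negMulLog (∏ i, p i (a i)) = ∑ i, ∑ x, Real.negMulLog (p i x) := by
  simp_rw [negMulLog_prod]
  rw [sum_comm]
  refine sum_congr rfl fun i _ => ?_
  rw [← Fintype.prod_sum fun j x => if j = i then Real.negMulLog (p j x) else p j x,
    Fintype.prod_eq_single i fun j hj => by simp [hj, hp]]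
  simp

theorem sum_negMulLog_const_mul {β : Type*} [Fintype β] (c : ℝ) (q : β → ℝ)
    (hq : ∑ x, q x = 1) :
    ∑ x, Real.negMulLog (c * q x) = Real.negMulLog c + c * ∑ x, Real.negMulLog (q x) := by
  simp_rw [Real.negMulLog_mul]
  rw [sum_add_distrib, ← sum_mul, hq, one_mul, mul_sum]

theorem condEnt_eq_sum {Ω : Type*} [MeasurableSpace Ω] (P : Measure Ω)
    {α γ : Type*} [Fintype α] [Fintype γ] (A : Ω → α) (Y : Ω → γ) :
    condEnt P A Y = ∑ b, (∑ x, Real.negMulLog (pr P (fun ω => (A ω, Y ω)) (x, b))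
      - Real.negMulLog (pr P Y b)) := by
  rw [condEnt, ent, ent, Fintype.sum_prod_type_right, sum_sub_distrib]

theorem mi_eq_ent_sub_condEnt {Ω : Type*} [MeasurableSpace Ω] (P : Measure Ω)
    {α γ : Type*} [Fintype α] [Fintype γ] (A : Ω → α) (Y : Ω → γ) :
    mi P A Y = ent P A - condEnt P A Y := by
  rw [mi, condEnt]
  ring

theorem pr_prodMk_eq_zero {Ω : Type*} [MeasurableSpace Ω] (P : Measure Ω) [IsFiniteMeasure P]
    {α γ : Type*} (A : Ω → α) {Y : Ω → γ} {b : γ} (hb : pr P Y b = 0) (x : α) :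
    pr P (fun ω => (A ω, Y ω)) (x, b) = 0 :=
  measureReal_mono_null (fun _ hω => congrArg Prod.snd hω) hb

/-- Conditional entropy is additive over conditionally independent families. -/
theorem condEnt_pi_eq_sum {Ω : Type*} [MeasurableSpace Ω] (P : Measure Ω) [IsFiniteMeasure P]
    {ι : Type*} [Fintype ι] [DecidableEq ι] {α : ι → Type*} [∀ i, Fintype (α i)]
    [∀ i, MeasurableSpace (α i)] [∀ i, MeasurableSingletonClass (α i)]
    {γ : Type*} [Fintype γ] (h : ∀ i, Ω → α i) (y : Ω → γ) (hmeas : ∀ i, Measurable (h i))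
    (hcondIndep : ∀ b : γ, 0 < pr P y b → ∀ a : ∀ i, α i,
      pr P (fun ω => ((fun i => h i ω), y ω)) (a, b) / pr P y b
        = ∏ i, (pr P (fun ω => (h i ω, y ω)) (a i, b) / pr P y b)) :
    condEnt P (fun ω i => h i ω) y = ∑ i, condEnt P (h i) y := by
  simp_rw [condEnt_eq_sum]
  rw [sum_comm]
  refine sum_congr rfl fun b _ => ?_
  obtain hb | hb : 0 = pr P y b ∨ 0 < pr P y b := ENNReal.toReal_nonneg.eq_or_lt
  · simp [pr_prodMk_eq_zero P _ hb.symm, ← hb]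
  have hq : ∀ i, ∑ x, pr P (fun ω => (h i ω, y ω)) (x, b) / pr P y b = 1 := fun i => by
    rw [← sum_div, sum_pr_prodMk P (hmeas i) y, div_self hb.ne']
  have hq_pi : ∑ a : ∀ i, α i, ∏ i, (pr P (fun ω => (h i ω, y ω)) (a i, b) / pr P y b) = 1 := by
    rw [← Fintype.prod_sum fun i x => pr P (fun ω => (h i ω, y ω)) (x, b) / pr P y b]
    simp [hq]
  have hjoint : ∀ a : ∀ i, α i, pr P (fun ω => ((fun i => h i ω), y ω)) (a, b)
      = pr P y b * ∏ i, (pr P (fun ω => (h i ω, y ω)) (a i, b) / pr P y b) := fun a => by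
    rw [← hcondIndep b hb a, mul_div_cancel₀ _ hb.ne']
  have hmarg : ∀ i, ∑ x, Real.negMulLog (pr P (fun ω => (h i ω, y ω)) (x, b))
      = Real.negMulLog (pr P y b)
        + pr P y b * ∑ x, Real.negMulLog (pr P (fun ω => (h i ω, y ω)) (x, b) / pr P y b) :=
    fun i => by
      rw [← sum_negMulLog_const_mul _ _ (hq i)]
      simp_rw [mul_div_cancel₀ _ hb.ne']
  simp_rw [hjoint, hmarg]
  rw [sum_negMulLog_const_mul _ _ hq_pi,
    sum_negMulLog_prod (fun i x => pr P (fun ω => (h i ω, y ω)) (x, b) / pr P y b) hq]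
  simp_rw [add_sub_cancel_left]
  rw [mul_sum]

/-- The entropy of an independent family is the sum of the entropies of its members. -/
theorem ent_pi_eq_sum {Ω : Type*} [MeasurableSpace Ω] (P : Measure Ω) [IsProbabilityMeasure P]
    {ι : Type*} [Fintype ι] [DecidableEq ι] {α : ι → Type*} [∀ i, Fintype (α i)]
    [∀ i, MeasurableSpace (α i)] [∀ i, MeasurableSingletonClass (α i)]
    (h : ∀ i, Ω → α i) (hmeas : ∀ i, Measurable (h i))
    (hindep : ∀ a : ∀ i, α i, pr P (fun ω i => h i ω) a = ∏ i, pr P (h i) (a i)) :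
    ent P (fun ω i => h i ω) = ∑ i, ent P (h i) := by
  simp_rw [ent, hindep]
  exact sum_negMulLog_prod _ fun i => sum_pr P (hmeas i)

/-- If `h₁,…,h_k` are mutually independent and conditionally mutually
independent given `y`, then `I((h₁,…,h_k); y) = ∑ᵢ I(hᵢ; y)`. -/
theorem mi_joint_eq_sum_of_indep_of_condIndep
    {Ω : Type*} [MeasurableSpace Ω] (P : Measure Ω) [IsProbabilityMeasure P]
    {k : ℕ} {α : Fin k → Type*} [∀ i, Fintype (α i)] [∀ i, Nonempty (α i)]
    [∀ i, MeasurableSpace (α i)] [∀ i, MeasurableSingletonClass (α i)]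
    {γ : Type*} [Fintype γ] [Nonempty γ] [MeasurableSpace γ] [MeasurableSingletonClass γ]
    (h : ∀ i, Ω → α i) (y : Ω → γ)
    (hmeas : ∀ i, Measurable (h i)) (hy : Measurable y)
    (hindep : ∀ a : ∀ i, α i,
      pr P (fun ω i => h i ω) a = ∏ i, pr P (h i) (a i))
    (hcondIndep : ∀ b : γ, 0 < pr P y b → ∀ a : ∀ i, α i,
      pr P (fun ω => ((fun i => h i ω), y ω)) (a, b) / pr P y b
        = ∏ i, (pr P (fun ω => (h i ω, y ω)) (a i, b) / pr P y b)) :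
    mi P (fun ω i => h i ω) y = ∑ i, mi P (h i) y := by
  simp_rw [mi_eq_ent_sub_condEnt]
  rw [sum_sub_distrib, ent_pi_eq_sum P h hmeas hindep,
    condEnt_pi_eq_sum P h y hmeas hcondIndep]
end

section
/- Let m ≥ 1, let q be a subset of {0,…,m−1} with cardinality k ≥ 1, and let φ : ℝ → ℝ. Suppose there exists a family of functions g_i : (Fin m → ℝ) → ℝ indexed by i ∈ q, each g_i not depending on coordinate i (i.e., g_i(x) = g_i(x') whenever x and x' agree on all coordinates other than i), such that for every x : Fin m → ℝ, φ( Σ_{i∈q} x_i ) = Σ_{i∈q} g_i(x). Then all k-th order iterated finite differences of φ vanish: for every s ∈ ℝ and every family of increments h : q → ℝ, Σ_{S ⊆ q} (−1)^{k − |S|} · φ( s + Σ_{j∈S} h_j ) = 0. -/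
open Finset

/-- An alternating sum over the subsets of `q` vanishes if its terms are insensitive to
inserting some fixed element `i ∈ q`. -/
theorem sum_powerset_neg_one_pow_mul_eq_zero {α R : Type*} [DecidableEq α] [Ring R]
    {q : Finset α} {i : α} (hi : i ∈ q) (F : Finset α → R)
    (hF : ∀ T ⊆ q.erase i, F (insert i T) = F T) :
    ∑ S ∈ q.powerset, (-1 : R) ^ (q.card - S.card) * F S = 0 := by
  have hsplit := sum_powerset_insert (notMem_erase i q)
    fun S => (-1 : R) ^ (q.card - S.card) * F S
  rw [insert_erase hi] at hsplit
  rw [hsplit, ← sum_add_distrib]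
  refine sum_eq_zero fun T hT => ?_
  rw [mem_powerset] at hT
  have hiT : i ∉ T := fun hmem => notMem_erase i q (hT hmem)
  have hlt : T.card < q.card :=
    (card_le_card hT).trans_lt (card_erase_lt_of_mem hi)
  rw [hF T hT, card_insert_of_notMem hiT,
    show q.card - T.card = q.card - (T.card + 1) + 1 by omega, pow_succ]
  simp

/-- if `φ(∑_{i∈q} x_i)` decomposes as `∑_{i∈q} g_i(x)` with each `g_i`
not depending on coordinate `i`, then all `k`-th order iterated finite differences of `φ`
vanish: `∑_{S ⊆ q} (−1)^{k−|S|} φ(s + ∑_{j∈S} h_j) = 0`. -/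
theorem iterated_difference_vanishes_of_decomposable
    {m : ℕ} (hm : 1 ≤ m) (q : Finset (Fin m)) (hk : 1 ≤ q.card)
    (φ : ℝ → ℝ) (g : Fin m → (Fin m → ℝ) → ℝ)
    (hdep : ∀ i ∈ q, ∀ x x' : Fin m → ℝ, (∀ j, j ≠ i → x j = x' j) → g i x = g i x')
    (hdecomp : ∀ x : Fin m → ℝ, φ (∑ i ∈ q, x i) = ∑ i ∈ q, g i x) :
    ∀ (s : ℝ) (h : Fin m → ℝ),
      ∑ S ∈ q.powerset, (-1 : ℝ) ^ (q.card - S.card) * φ (s + ∑ j ∈ S, h j) = 0 := by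
  intro s h
  obtain ⟨a, ha⟩ := card_pos.mp hk
  let x : Finset (Fin m) → Fin m → ℝ := fun S j =>
    (if j = a then s else 0) + if j ∈ S then h j else 0
  have hx : ∀ S ∈ q.powerset, φ (s + ∑ j ∈ S, h j) = ∑ i ∈ q, g i (x S) := by
    intro S hS
    rw [← hdecomp, sum_add_distrib, sum_ite_eq' q a, if_pos ha, sum_ite_mem,
      inter_eq_right.mpr (mem_powerset.mp hS)]
  rw [sum_congr rfl fun S hS => by rw [hx S hS, mul_sum], sum_comm]
  refine sum_eq_zero fun i hi =>
    sum_powerset_neg_one_pow_mul_eq_zero hi (fun S => g i (x S)) fun T _ => ?_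
  refine hdep i hi _ _ fun j hj => ?_
  simp [x, hj]
end

section
/- Let m ≥ 1, let q be a subset of {0,…,m−1} with cardinality k ≥ 1, and let φ : ℝ → ℝ be a polynomial function of degree strictly less than k. Then the converse decomposition holds: there exists a family of functions g_i : (Fin m → ℝ) → ℝ indexed by i ∈ q, each g_i not depending on coordinate i, such that for every x : Fin m → ℝ, φ( Σ_{i∈q} x_i ) = Σ_{i∈q} g_i(x). In particular, q is not a statistical interaction of the function x ↦ φ(Σ_{i∈q} x_i). -/
open Finset

/-- The real functions on `ι → ℝ` that do not depend on coordinate `i`. -/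
def independentOfCoord {ι : Type*} (i : ι) : Submodule ℝ ((ι → ℝ) → ℝ) where
  carrier := {f | ∀ x x' : ι → ℝ, (∀ j, j ≠ i → x j = x' j) → f x = f x'}
  add_mem' hf hg x x' h := congrArg₂ (· + ·) (hf x x' h) (hg x x' h)
  zero_mem' _ _ _ := rfl
  smul_mem' c _ hf x x' h := congrArg (c * ·) (hf x x' h)

/-- A monomial of degree less than `q.card` omits some variable indexed by `q`. -/
lemma prod_coord_mem_iSup_independentOfCoord {ι : Type*} {q : Finset ι} {n : ℕ}
    (hn : n < q.card) (f : Fin n → ι) :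
    (fun x : ι → ℝ ↦ ∏ j, x (f j)) ∈ ⨆ i ∈ q, independentOfCoord i := by
  classical
  obtain ⟨i, hi, hif⟩ : ∃ i ∈ q, i ∉ univ.image f :=
    exists_mem_notMem_of_card_lt_card (card_image_le.trans_lt (by simpa using hn))
  refine Submodule.mem_iSup_of_mem i (Submodule.mem_iSup_of_mem hi fun x x' h ↦ ?_)
  exact prod_congr rfl fun j _ ↦ h _ fun hj ↦ hif (mem_image.2 ⟨j, mem_univ j, hj⟩)

/-- A power of `∑ i ∈ q, x i` with exponent less than `q.card` is a sum of functions each independent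
of some coordinate in `q`. -/
lemma sum_coord_pow_mem_iSup_independentOfCoord {ι : Type*} {q : Finset ι} {n : ℕ}
    (hn : n < q.card) :
    (fun x : ι → ℝ ↦ (∑ i ∈ q, x i) ^ n) ∈ ⨆ i ∈ q, independentOfCoord i := by
  classical
  have h : (fun x : ι → ℝ ↦ (∑ i ∈ q, x i) ^ n) =
      ∑ f ∈ Fintype.piFinset fun _ : Fin n ↦ q, fun x : ι → ℝ ↦ ∏ j, x (f j) := by
    ext x
    rw [Finset.sum_apply, sum_pow']
  rw [h]
  exact Submodule.sum_mem _ fun f _ ↦ prod_coord_mem_iSup_independentOfCoord hn f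

/-- if `φ` is a polynomial function of degree `< k = |q|`, then
`φ(∑_{i∈q} x_i)` decomposes as `∑_{i∈q} g_i(x)` with each `g_i` not depending on
coordinate `i`; in particular `q` is not a statistical interaction of
`x ↦ φ(∑_{i∈q} x_i)`. -/
theorem low_degree_polynomial_decomposable
    {m : ℕ} (hm : 1 ≤ m) (q : Finset (Fin m)) (hk : 1 ≤ q.card)
    (p : Polynomial ℝ) (hdeg : p.natDegree < q.card) :
    ∃ g : Fin m → (Fin m → ℝ) → ℝ,
      (∀ i ∈ q, ∀ x x' : Fin m → ℝ, (∀ j, j ≠ i → x j = x' j) → g i x = g i x') ∧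
      ∀ x : Fin m → ℝ, p.eval (∑ i ∈ q, x i) = ∑ i ∈ q, g i x := by
  have hmem : (fun x : Fin m → ℝ ↦ p.eval (∑ i ∈ q, x i)) ∈ ⨆ i ∈ q, independentOfCoord i := by
    have h : (fun x : Fin m → ℝ ↦ p.eval (∑ i ∈ q, x i)) =
        ∑ n ∈ range (p.natDegree + 1), p.coeff n • fun x : Fin m → ℝ ↦ (∑ i ∈ q, x i) ^ n := by
      ext x
      simp [Polynomial.eval_eq_sum_range]
    rw [h]
    refine Submodule.sum_mem _ fun n hn ↦ Submodule.smul_mem _ _ ?_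
    exact sum_coord_pow_mem_iSup_independentOfCoord
      ((Nat.lt_succ_iff.1 (mem_range.1 hn)).trans_lt hdeg)
  obtain ⟨g, hg⟩ := (Submodule.mem_iSup_finset_iff_exists_sum _ _).1 hmem
  refine ⟨fun i ↦ g i, fun i _ ↦ (g i).2, fun x ↦ ?_⟩
  simpa using (congrFun hg x).symm
end
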